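/- Assume d(n)/n → 0. (i) If in addition d(n) → ∞ and (ln n)/d → 0, then √(d/ln(n/d))·H_typ → √2 in probability; concretely, for every fixed ε ∈ (0,√2), I(n,d, (√2−ε)√(ln(n/d)/d), (√2+ε)√(ln(n/d)/d))/I(n,d,−1,1) → 1. (ii) If (ln n)/d → ρ for some ρ ∈ (0,∞), then H_typ → √(1−e^{−2ρ}) in probability; concretely, with L = √(1−e^{−2ρ}), for every fixed ε ∈ (0,L), I(n,d, L−ε, min(L+ε,1))/I(n,d,−1,1) → 1. (iii) If (ln n)/d → ∞, then −((d−1)/ln n)·ln(1−H_typ²) → 2 in probability; concretely, for every fixed ε ∈ (0,2), with a_n = √(1−n^{−(2−ε)/(d−1)}) and b_n = √(1−n^{−(2+ε)/(d−1)}), [I(n,d,a_n,b_n) + I(n,d,−b_n,−a_n)]/I(n,d,−1,1) → 1. -/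

import Mathlib

open Filter

noncomputable def c1 (d : ℕ) : ℝ :=
  Real.Gamma ((d : ℝ) / 2) / (Real.sqrt Real.pi * Real.Gamma (((d : ℝ) - 1) / 2))

noncomputable def c2 (d : ℕ) : ℝ :=
  Real.Gamma (((d : ℝ) ^ 2 - 2 * (d : ℝ) + 2) / 2) /
    (Real.sqrt Real.pi * Real.Gamma (((d : ℝ) ^ 2 - 2 * (d : ℝ) + 1) / 2))

/-- `II n d a b` is the integral `I(n,d,a,b)` from the paper. -/
noncomputable def II (n d : ℕ) (a b : ℝ) : ℝ :=
  ∫ h in a..b, (1 - h ^ 2) ^ (((d : ℝ) ^ 2 - 2 * (d : ℝ) - 1) / 2) *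
    (c1 d * ∫ s in (-1 : ℝ)..h, (1 - s ^ 2) ^ (((d : ℝ) - 3) / 2)) ^ (n - d)

/-- `FF n d a b` is the expected number of facets with height in `[a,b]`. -/
noncomputable def FF (n d : ℕ) (a b : ℝ) : ℝ :=
  (n.choose d : ℝ) * 2 * c2 d * II n d a b

/-- The standard normal CDF. -/
noncomputable def stdPhi (r : ℝ) : ℝ :=
  (Real.sqrt (2 * Real.pi))⁻¹ * ∫ s in Set.Iic r, Real.exp (-s ^ 2 / 2)


theorem beta_integrand_eq (x : ℝ) {t : ℝ} (ht : t ∈ Set.uIcc (0 : ℝ) 1) :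
    (t : ℂ) ^ ((x : ℂ) - 1) * (1 - (t : ℂ)) ^ ((x : ℂ) - 1) =
      (((t * (1 - t)) ^ (x - 1) : ℝ) : ℂ) := by
  rw [Set.uIcc_of_le zero_le_one] at ht
  have h1 : 0 ≤ 1 - t := by linarith [ht.2]
  rw [Real.mul_rpow ht.1 h1, Complex.ofReal_mul, Complex.ofReal_cpow ht.1,
    Complex.ofReal_cpow h1]
  push_cast
  rfl

theorem intervalIntegrable_mul_one_sub_rpow {x : ℝ} (hx : 0 < x) :
    IntervalIntegrable (fun t : ℝ => (t * (1 - t)) ^ (x - 1)) MeasureTheory.volume 0 1 := by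
  have h := Complex.betaIntegral_convergent (u := (x : ℂ)) (v := (x : ℂ)) (by simpa) (by simpa)
  have h2 : IntervalIntegrable (fun t : ℝ => (((t * (1 - t)) ^ (x - 1) : ℝ) : ℂ))
      MeasureTheory.volume 0 1 := by
    refine h.congr fun t ht => ?_
    exact beta_integrand_eq x (Set.uIoc_subset_uIcc ht)
  exact ⟨h2.1.re, h2.2.re⟩

theorem integral_mul_one_sub_rpow {x : ℝ} (hx : 0 < x) :
    ∫ t in (0 : ℝ)..1, (t * (1 - t)) ^ (x - 1) =
      Real.Gamma x * Real.Gamma x / Real.Gamma (2 * x) := by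
  have h := Complex.Gamma_mul_Gamma_eq_betaIntegral (s := (x : ℂ)) (t := (x : ℂ))
    (by simpa) (by simpa)
  have h3 : Complex.betaIntegral x x =
      ((∫ t in (0 : ℝ)..1, (t * (1 - t)) ^ (x - 1) : ℝ) : ℂ) := by
    rw [Complex.betaIntegral, ← intervalIntegral.integral_ofReal]
    exact intervalIntegral.integral_congr fun t ht => beta_integrand_eq x ht
  rw [h3, ← Complex.ofReal_add, Complex.Gamma_ofReal, Complex.Gamma_ofReal] at h
  have h4 : Real.Gamma x * Real.Gamma x =
      Real.Gamma (x + x) * ∫ t in (0 : ℝ)..1, (t * (1 - t)) ^ (x - 1) := by exact_mod_cast h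
  have : 0 < Real.Gamma (2 * x) := Real.Gamma_pos_of_pos (by linarith)
  rw [h4, ← two_mul]
  field_simp

theorem one_sub_sq_rpow_eq (x : ℝ) {s : ℝ} (hs : s ∈ Set.uIcc (-1 : ℝ) 1) :
    (1 - s ^ 2) ^ (x - 1) =
      4 ^ (x - 1) * ((1 / 2 * s + 1 / 2) * (1 - (1 / 2 * s + 1 / 2))) ^ (x - 1) := by
  rw [Set.uIcc_of_le (by norm_num)] at hs
  rw [← Real.mul_rpow (by norm_num) (mul_nonneg (by linarith [hs.1]) (by linarith [hs.2]))]
  congr 1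
  ring

theorem intervalIntegrable_one_sub_sq_rpow {x : ℝ} (hx : 0 < x) :
    IntervalIntegrable (fun s : ℝ => (1 - s ^ 2) ^ (x - 1)) MeasureTheory.volume (-1) 1 := by
  have h := ((intervalIntegrable_mul_one_sub_rpow hx).comp_add_right (1 / 2)).comp_mul_left
    (c := 1 / 2)
  norm_num at h
  refine (h.const_mul (4 ^ (x - 1))).congr fun s hs => ?_
  have := one_sub_sq_rpow_eq x (Set.uIoc_subset_uIcc hs)
  simp only [this]

theorem integral_one_sub_sq_rpow {x : ℝ} (hx : 0 < x) :
    ∫ s in (-1 : ℝ)..1, (1 - s ^ 2) ^ (x - 1) =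
      √Real.pi * Real.Gamma x / Real.Gamma (x + 1 / 2) := by
  rw [intervalIntegral.integral_congr fun s hs => one_sub_sq_rpow_eq x hs,
    intervalIntegral.integral_const_mul,
    intervalIntegral.integral_comp_mul_add (fun t : ℝ => (t * (1 - t)) ^ (x - 1))
      (by norm_num : (1 / 2 : ℝ) ≠ 0)]
  norm_num
  rw [integral_mul_one_sub_rpow hx]
  have h := Real.Gamma_mul_Gamma_add_half x
  have h1 : 0 < Real.Gamma (2 * x) := Real.Gamma_pos_of_pos (by linarith)
  have h2 : 0 < Real.Gamma (x + 1 / 2) := Real.Gamma_pos_of_pos (by linarith)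
  have h5 : (4 : ℝ) ^ (x - 1) * 2 * 2 ^ (1 - 2 * x) = 1 := by
    have : (4 : ℝ) = 2 ^ (2 : ℝ) := by norm_num
    rw [this, ← Real.rpow_mul (by norm_num), mul_right_comm, ← Real.rpow_add (by norm_num)]
    ring_nf
    norm_num [Real.rpow_neg]
  rw [eq_div_iff h2.ne']
  field_simp
  calc _ = 4 ^ (x - 1) * 2 * (Real.Gamma x * Real.Gamma (x + 1 / 2)) := by ring_nf
    _ = (4 ^ (x - 1) * 2 * 2 ^ (1 - 2 * x)) * (√Real.pi * Real.Gamma (2 * x)) := by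
      rw [h]; ring_nf
    _ = _ := by rw [h5]; ring_nf

theorem sq_Gamma_add_half_le {x : ℝ} (hx : 0 < x) :
    Real.Gamma (x + 1 / 2) ^ 2 ≤ x * Real.Gamma x ^ 2 := by
  have h := Real.Gamma_mul_add_mul_le_rpow_Gamma_mul_rpow_Gamma hx (by linarith : 0 < x + 1)
    (by norm_num : (0 : ℝ) < 1 / 2) (by norm_num : (0 : ℝ) < 1 / 2) (by norm_num)
  have e : 1 / 2 * x + 1 / 2 * (x + 1) = x + 1 / 2 := by ring
  have h1 := Real.Gamma_pos_of_pos hx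
  have h2 := Real.Gamma_pos_of_pos (by linarith : 0 < x + 1)
  rw [e, ← Real.sqrt_eq_rpow, ← Real.sqrt_eq_rpow, ← Real.sqrt_mul h1.le,
    Real.Gamma_add_one hx.ne'] at h
  have h3 := Real.Gamma_pos_of_pos (by linarith : 0 < x + 1 / 2)
  calc _ ≤ √(Real.Gamma x * (x * Real.Gamma x)) ^ 2 := by gcongr
    _ = _ := by rw [Real.sq_sqrt (by positivity)]; ring

theorem le_sq_Gamma_add_half {x : ℝ} (hx : 1 / 2 ≤ x) :
    x / 2 * Real.Gamma x ^ 2 ≤ Real.Gamma (x + 1 / 2) ^ 2 := by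
  have h := sq_Gamma_add_half_le (by linarith : 0 < x + 1 / 2)
  rw [add_assoc, show (1 / 2 + 1 / 2 : ℝ) = 1 by norm_num,
    Real.Gamma_add_one (by linarith : x ≠ 0)] at h
  have h3 : 0 ≤ Real.Gamma (x + 1 / 2) ^ 2 := by positivity
  have : x * (x * Real.Gamma x ^ 2) ≤ x * (2 * Real.Gamma (x + 1 / 2) ^ 2) := by nlinarith
  have := le_of_mul_le_mul_left this (by linarith)
  linarith

theorem sqrt_pi_le_two : √Real.pi ≤ 2 := by
  rw [Real.sqrt_le_left (by norm_num)]
  linarith [Real.pi_lt_four]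

theorem integral_one_sub_sq_rpow_le {x : ℝ} (hx : 1 / 2 ≤ x) :
    ∫ s in (-1 : ℝ)..1, (1 - s ^ 2) ^ (x - 1) ≤ 4 := by
  rw [integral_one_sub_sq_rpow (by linarith)]
  have h1 := Real.Gamma_pos_of_pos (by linarith : 0 < x)
  have h2 := Real.Gamma_pos_of_pos (by linarith : 0 < x + 1 / 2)
  have h3 := le_sq_Gamma_add_half hx
  have h4 : Real.Gamma x ≤ 2 * Real.Gamma (x + 1 / 2) := by
    refine abs_le_of_sq_le_sq' ?_ (by positivity) |>.2
    nlinarith [sq_nonneg (Real.Gamma x)]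
  rw [div_le_iff₀ h2]
  nlinarith [sqrt_pi_le_two, Real.sqrt_nonneg Real.pi]

theorem integral_mul_one_sub_sq_rpow {x a b : ℝ} (hx : 0 < x) (ha : -1 ≤ a) (hab : a ≤ b)
    (hb : b ≤ 1) :
    ∫ s in a..b, s * (1 - s ^ 2) ^ (x - 1) =
      ((1 - a ^ 2) ^ x - (1 - b ^ 2) ^ x) / (2 * x) := by
  have hint : IntervalIntegrable (fun s : ℝ => s * (1 - s ^ 2) ^ (x - 1))
      MeasureTheory.volume a b := by
    refine ((intervalIntegrable_one_sub_sq_rpow hx).continuousOn_mul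
      continuousOn_id).mono_set ?_
    rw [Set.uIcc_of_le hab, Set.uIcc_of_le (by norm_num)]
    exact Set.Icc_subset_Icc ha hb
  rw [intervalIntegral.integral_eq_sub_of_hasDerivAt_of_le
    (f := fun s => -((1 - s ^ 2) ^ x / (2 * x))) hab _ _ hint]
  · ring
  · refine ContinuousOn.neg (ContinuousOn.div_const ?_ _)
    exact ContinuousOn.rpow_const (by fun_prop) fun _ _ => Or.inr hx.le
  · intro s hs
    have h0 : 0 < 1 - s ^ 2 := by nlinarith [hs.1, hs.2]
    have h1 : HasDerivAt (fun s : ℝ => 1 - s ^ 2) (-(2 * s)) s := by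
      simpa using (hasDerivAt_pow 2 s).const_sub 1
    have h2 := ((h1.rpow_const (p := x) (Or.inl h0.ne')).div_const (2 * x)).neg
    refine h2.congr_deriv ?_
    field_simp

theorem intervalIntegrable_one_sub_sq_rpow' {x a b : ℝ} (hx : 0 < x) (ha : -1 ≤ a) (hab : a ≤ b)
    (hb : b ≤ 1) :
    IntervalIntegrable (fun s : ℝ => (1 - s ^ 2) ^ (x - 1)) MeasureTheory.volume a b := by
  refine (intervalIntegrable_one_sub_sq_rpow hx).mono_set ?_
  rw [Set.uIcc_of_le hab, Set.uIcc_of_le (by norm_num)]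
  exact Set.Icc_subset_Icc ha hb

theorem one_sub_sq_rpow_nonneg {s : ℝ} (x : ℝ) (hs : s ∈ Set.Icc (-1 : ℝ) 1) :
    0 ≤ (1 - s ^ 2) ^ x :=
  Real.rpow_nonneg (by nlinarith [hs.1, hs.2]) _

/-- On `[a, b] ⊆ [0, 1]` the integrand dominates `s / b` times itself, which has an explicit primitive. -/
theorem le_integral_one_sub_sq_rpow {x a b : ℝ} (hx : 0 < x) (ha : 0 ≤ a) (hab : a ≤ b)
    (hb : b ≤ 1) :
    (1 - a ^ 2) ^ x - (1 - b ^ 2) ^ x ≤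
      2 * x * (b * ∫ s in a..b, (1 - s ^ 2) ^ (x - 1)) := by
  have hi := intervalIntegrable_one_sub_sq_rpow' hx (by linarith) hab hb
  have h := integral_mul_one_sub_sq_rpow hx (by linarith) hab hb
  rw [eq_div_iff (by positivity)] at h
  rw [← h, ← intervalIntegral.integral_const_mul, mul_comm]
  gcongr
  refine intervalIntegral.integral_mono_on hab (hi.continuousOn_mul continuousOn_id)
    (hi.const_mul b) fun s hs => ?_
  exact mul_le_mul_of_nonneg_right hs.2
    (one_sub_sq_rpow_nonneg _ ⟨by linarith [hs.1], by linarith [hs.2]⟩)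

theorem integral_one_sub_sq_rpow_le_of_nonneg {x a : ℝ} (hx : 0 < x) (ha : 0 ≤ a)
    (ha1 : a ≤ 1) :
    2 * x * (a * ∫ s in a..1, (1 - s ^ 2) ^ (x - 1)) ≤ (1 - a ^ 2) ^ x := by
  have hi := intervalIntegrable_one_sub_sq_rpow' hx (by linarith) ha1 le_rfl
  have h := integral_mul_one_sub_sq_rpow hx (by linarith) ha1 le_rfl
  rw [eq_div_iff (by positivity)] at h
  norm_num [Real.zero_rpow hx.ne'] at h
  rw [← h, ← intervalIntegral.integral_const_mul, mul_comm]
  gcongr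
  refine intervalIntegral.integral_mono_on ha1 (hi.const_mul a)
    (hi.continuousOn_mul continuousOn_id) fun s hs => ?_
  exact mul_le_mul_of_nonneg_right hs.1
    (one_sub_sq_rpow_nonneg _ ⟨by linarith [hs.1], by linarith [hs.2]⟩)

/-- The distribution function of one coordinate of a uniform point on the sphere in `ℝ^d`. -/
noncomputable def heightCDF (d : ℕ) (h : ℝ) : ℝ :=
  c1 d * ∫ s in (-1 : ℝ)..h, (1 - s ^ 2) ^ (((d : ℝ) - 3) / 2)

theorem half_exponent_eq (d : ℕ) : ((d : ℝ) - 3) / 2 = ((d : ℝ) - 1) / 2 - 1 := by ring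

theorem weight_exponent_eq (d : ℕ) :
    ((d : ℝ) ^ 2 - 2 * (d : ℝ) - 1) / 2 = ((d : ℝ) - 1) ^ 2 / 2 - 1 := by ring

theorem one_le_sub_one {d : ℕ} (hd : 2 ≤ d) : (1 : ℝ) ≤ (d : ℝ) - 1 := by
  have : (2 : ℝ) ≤ d := by exact_mod_cast hd
  linarith

theorem c1_pos {d : ℕ} (hd : 2 ≤ d) : 0 < c1 d := by
  have := one_le_sub_one hd
  have h1 := Real.Gamma_pos_of_pos (by linarith : 0 < ((d : ℝ) - 1) / 2)
  have h2 := Real.Gamma_pos_of_pos (by linarith : 0 < (d : ℝ) / 2)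
  have := Real.pi_pos
  unfold c1
  positivity

theorem sq_c1_le {d : ℕ} (hd : 2 ≤ d) : c1 d ^ 2 ≤ ((d : ℝ) - 1) / 6 := by
  have := one_le_sub_one hd
  have h1 := Real.Gamma_pos_of_pos (by linarith : 0 < ((d : ℝ) - 1) / 2)
  have h := sq_Gamma_add_half_le (by linarith : 0 < ((d : ℝ) - 1) / 2)
  rw [show ((d : ℝ) - 1) / 2 + 1 / 2 = d / 2 by ring] at h
  have hp := Real.pi_gt_three
  rw [c1, div_pow, mul_pow, Real.sq_sqrt (by positivity), div_le_iff₀ (by positivity)]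
  nlinarith [mul_nonneg (mul_nonneg (by linarith : 0 ≤ (d : ℝ) - 1)
    (sq_nonneg (Real.Gamma (((d : ℝ) - 1) / 2)))) (by linarith : 0 ≤ Real.pi - 3)]

theorem le_sq_c1 {d : ℕ} (hd : 2 ≤ d) : ((d : ℝ) - 1) / 16 ≤ c1 d ^ 2 := by
  have := one_le_sub_one hd
  have h1 := Real.Gamma_pos_of_pos (by linarith : 0 < ((d : ℝ) - 1) / 2)
  have h := le_sq_Gamma_add_half (by linarith : 1 / 2 ≤ ((d : ℝ) - 1) / 2)
  rw [show ((d : ℝ) - 1) / 2 + 1 / 2 = d / 2 by ring] at h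
  have hp := Real.pi_lt_four
  have hp0 := Real.pi_pos
  rw [c1, div_pow, mul_pow, Real.sq_sqrt (by positivity), le_div_iff₀ (by positivity)]
  nlinarith [mul_nonneg (mul_nonneg (by linarith : 0 ≤ (d : ℝ) - 1)
    (sq_nonneg (Real.Gamma (((d : ℝ) - 1) / 2)))) (by linarith : 0 ≤ 4 - Real.pi)]

theorem heightCDF_one {d : ℕ} (hd : 2 ≤ d) : heightCDF d 1 = 1 := by
  have := one_le_sub_one hd
  have h1 := Real.Gamma_pos_of_pos (by linarith : 0 < ((d : ℝ) - 1) / 2)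
  have h2 := Real.Gamma_pos_of_pos (by linarith : 0 < (d : ℝ) / 2)
  have := Real.pi_pos
  rw [heightCDF, half_exponent_eq, integral_one_sub_sq_rpow (by linarith), c1,
    show ((d : ℝ) - 1) / 2 + 1 / 2 = d / 2 by ring]
  field_simp

theorem one_sub_heightCDF {d : ℕ} (hd : 2 ≤ d) {h : ℝ} (h0 : -1 ≤ h) (h1 : h ≤ 1) :
    1 - heightCDF d h = c1 d * ∫ s in h..1, (1 - s ^ 2) ^ (((d : ℝ) - 1) / 2 - 1) := by
  have hm := one_le_sub_one hd
  have h2 := heightCDF_one hd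
  refine (congrArg (· - heightCDF d h) h2.symm).trans ?_
  simp only [heightCDF]
  rw [half_exponent_eq, ← mul_sub, intervalIntegral.integral_interval_sub_left]
  · exact intervalIntegrable_one_sub_sq_rpow (by linarith)
  · exact intervalIntegrable_one_sub_sq_rpow' (by linarith) le_rfl h0 h1

theorem heightCDF_mono {d : ℕ} (hd : 2 ≤ d) :
    MonotoneOn (heightCDF d) (Set.Icc (-1) 1) := by
  have hm := one_le_sub_one hd
  intro a ha b hb hab
  have : heightCDF d b - heightCDF d a =
      c1 d * ∫ s in a..b, (1 - s ^ 2) ^ (((d : ℝ) - 1) / 2 - 1) := by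
    rw [heightCDF, heightCDF, half_exponent_eq, ← mul_sub,
      intervalIntegral.integral_interval_sub_left]
    · exact intervalIntegrable_one_sub_sq_rpow' (by linarith) le_rfl hb.1 hb.2
    · exact intervalIntegrable_one_sub_sq_rpow' (by linarith) le_rfl ha.1 ha.2
  have h2 : 0 ≤ ∫ s in a..b, (1 - s ^ 2) ^ (((d : ℝ) - 1) / 2 - 1) :=
    intervalIntegral.integral_nonneg hab fun s hs =>
      one_sub_sq_rpow_nonneg _ ⟨by linarith [hs.1, ha.1], by linarith [hs.2, hb.2]⟩
  nlinarith [mul_nonneg (c1_pos hd).le h2]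

theorem heightCDF_nonneg {d : ℕ} (hd : 2 ≤ d) {h : ℝ} (hh : h ∈ Set.Icc (-1 : ℝ) 1) :
    0 ≤ heightCDF d h := by
  have := heightCDF_mono hd (by norm_num : (-1 : ℝ) ∈ Set.Icc (-1) 1) hh hh.1
  simpa [heightCDF] using this

theorem heightCDF_le_one {d : ℕ} (hd : 2 ≤ d) {h : ℝ} (hh : h ∈ Set.Icc (-1 : ℝ) 1) :
    heightCDF d h ≤ 1 := by
  rw [← heightCDF_one hd]
  exact heightCDF_mono hd hh (by norm_num) hh.2

theorem continuousOn_heightCDF {d : ℕ} (hd : 2 ≤ d) :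
    ContinuousOn (heightCDF d) (Set.uIcc (-1) 1) := by
  have hm := one_le_sub_one hd
  refine ContinuousOn.const_smul (intervalIntegral.continuousOn_primitive_interval ?_) (c1 d)
  rw [half_exponent_eq]
  exact (intervalIntegrable_iff' (by simp)).1
    (intervalIntegrable_one_sub_sq_rpow (by linarith : 0 < ((d : ℝ) - 1) / 2))

/-- The integrand of `II`. -/
noncomputable def heightDensity (n d : ℕ) (h : ℝ) : ℝ :=
  (1 - h ^ 2) ^ (((d : ℝ) - 1) ^ 2 / 2 - 1) * heightCDF d h ^ (n - d)

theorem II_eq (n d : ℕ) (a b : ℝ) : II n d a b = ∫ h in a..b, heightDensity n d h := by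
  simp only [II, heightDensity, heightCDF, weight_exponent_eq]

theorem intervalIntegrable_heightDensity (n : ℕ) {d : ℕ} (hd : 2 ≤ d) {a b : ℝ} (ha : -1 ≤ a)
    (hab : a ≤ b) (hb : b ≤ 1) :
    IntervalIntegrable (heightDensity n d) MeasureTheory.volume a b := by
  have hm := one_le_sub_one hd
  have h : IntervalIntegrable (heightDensity n d) MeasureTheory.volume (-1) 1 :=
    (intervalIntegrable_one_sub_sq_rpow (by positivity)).mul_continuousOn
      ((continuousOn_heightCDF hd).pow _)
  refine h.mono_set ?_
  rw [Set.uIcc_of_le hab, Set.uIcc_of_le (by norm_num)]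
  exact Set.Icc_subset_Icc ha hb

theorem heightDensity_nonneg (n : ℕ) {d : ℕ} (hd : 2 ≤ d) {h : ℝ}
    (hh : h ∈ Set.Icc (-1 : ℝ) 1) : 0 ≤ heightDensity n d h :=
  mul_nonneg (one_sub_sq_rpow_nonneg _ hh) (pow_nonneg (heightCDF_nonneg hd hh) _)

theorem II_nonneg (n : ℕ) {d : ℕ} (hd : 2 ≤ d) {a b : ℝ} (ha : -1 ≤ a)
    (hab : a ≤ b) (hb : b ≤ 1) : 0 ≤ II n d a b := by
  rw [II_eq]
  exact intervalIntegral.integral_nonneg hab fun s hs =>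
    heightDensity_nonneg n hd ⟨by linarith [hs.1], by linarith [hs.2]⟩

theorem II_add (n : ℕ) {d : ℕ} (hd : 2 ≤ d) {a b c : ℝ} (ha : -1 ≤ a)
    (hab : a ≤ b) (hbc : b ≤ c) (hc : c ≤ 1) : II n d a b + II n d b c = II n d a c := by
  rw [II_eq, II_eq, II_eq]
  exact intervalIntegral.integral_add_adjacent_intervals
    (intervalIntegrable_heightDensity n hd ha hab (hbc.trans hc))
    (intervalIntegrable_heightDensity n hd (ha.trans hab) hbc hc)

theorem II_mono (n : ℕ) {d : ℕ} (hd : 2 ≤ d) {a b a' b' : ℝ} (ha' : -1 ≤ a') (ha : a' ≤ a)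
    (hab : a ≤ b) (hb : b ≤ b') (hb' : b' ≤ 1) : II n d a b ≤ II n d a' b' := by
  rw [← II_add n hd ha' (ha.trans hab) hb hb', ← II_add n hd ha' ha hab (hb.trans hb')]
  linarith [II_nonneg n hd ha' ha (hab.trans (hb.trans hb')),
    II_nonneg n hd (by linarith) hb hb']

/-- The height `h` with `(1 - h ^ 2) ^ (m / 2) = exp (-t)`. -/
noncomputable def expHeight (m t : ℝ) : ℝ := √(1 - Real.exp (-(2 * t) / m))

theorem expHeight_nonneg (m t : ℝ) : 0 ≤ expHeight m t := Real.sqrt_nonneg _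

theorem expHeight_le_one (m t : ℝ) : expHeight m t ≤ 1 := by
  rw [expHeight, Real.sqrt_le_left zero_le_one]
  linarith [Real.exp_pos (-(2 * t) / m)]

theorem expHeight_mem_Icc (m t : ℝ) : expHeight m t ∈ Set.Icc (-1 : ℝ) 1 :=
  ⟨by linarith [expHeight_nonneg m t], expHeight_le_one m t⟩

theorem expHeight_mono {m t u : ℝ} (hm : 0 ≤ m) (htu : t ≤ u) :
    expHeight m t ≤ expHeight m u := by
  unfold expHeight
  gcongr

theorem sq_expHeight {m t : ℝ} (hm : 0 ≤ m) (ht : 0 ≤ t) :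
    expHeight m t ^ 2 = 1 - Real.exp (-(2 * t) / m) := by
  refine Real.sq_sqrt ?_
  rw [sub_nonneg, Real.exp_le_one_iff, neg_div]
  have : 0 ≤ 2 * t / m := by positivity
  linarith

theorem one_sub_sq_expHeight_rpow {m t : ℝ} (hm : 0 ≤ m) (ht : 0 ≤ t) (x : ℝ) :
    (1 - expHeight m t ^ 2) ^ x = Real.exp (-(2 * t) / m * x) := by
  rw [sq_expHeight hm ht, sub_sub_cancel, Real.exp_mul]

theorem one_sub_sq_expHeight_rpow_half {m t : ℝ} (hm : 0 < m) (ht : 0 ≤ t) :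
    (1 - expHeight m t ^ 2) ^ (m / 2) = Real.exp (-t) := by
  rw [one_sub_sq_expHeight_rpow hm.le ht]
  congr 1
  field_simp

theorem one_sub_sq_expHeight_rpow_sq_half {m t : ℝ} (hm : 0 < m) (ht : 0 ≤ t) :
    (1 - expHeight m t ^ 2) ^ (m ^ 2 / 2) = Real.exp (-(t * m)) := by
  rw [one_sub_sq_expHeight_rpow hm.le ht]
  congr 1
  field_simp

theorem sq_expHeight_le {m t : ℝ} (hm : 0 ≤ m) (ht : 0 ≤ t) :
    expHeight m t ^ 2 ≤ 2 * t / m := by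
  rw [sq_expHeight hm ht, neg_div]
  linarith [Real.add_one_le_exp (-(2 * t / m))]

theorem div_one_add_le_one_sub_exp_neg {x : ℝ} (hx : 0 ≤ x) :
    x / (1 + x) ≤ 1 - Real.exp (-x) := by
  rw [Real.exp_neg]
  have h : (Real.exp x)⁻¹ ≤ (1 + x)⁻¹ := by
    gcongr
    linarith [Real.add_one_le_exp x]
  have : x / (1 + x) = 1 - (1 + x)⁻¹ := by field_simp; ring
  linarith

theorem le_sq_expHeight {m t : ℝ} (hm : 1 ≤ m) (ht : 1 ≤ t) :
    2 / 3 ≤ m * expHeight m t ^ 2 := by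
  rw [sq_expHeight (by linarith) (by linarith), neg_div]
  have h := div_one_add_le_one_sub_exp_neg (by positivity : 0 ≤ 2 * t / m)
  have h2 : 2 / 3 ≤ m * (2 * t / m / (1 + 2 * t / m)) := by
    have : m * (2 * t / m / (1 + 2 * t / m)) = 2 * t * m / (m + 2 * t) := by field_simp
    rw [this, div_le_div_iff₀ (by norm_num) (by linarith)]
    nlinarith
  exact h2.trans (by gcongr)

theorem one_sub_heightCDF_expHeight_le {d : ℕ} (hd : 2 ≤ d) {t : ℝ} (ht : 1 ≤ t) :
    1 - heightCDF d (expHeight ((d : ℝ) - 1) t) ≤ Real.exp (-t) := by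
  have hm := one_le_sub_one hd
  set m : ℝ := (d : ℝ) - 1
  set a := expHeight m t with ha
  have ha0 : 0 ≤ a := expHeight_nonneg m t
  have ha1 : a ≤ 1 := expHeight_le_one m t
  rw [one_sub_heightCDF hd (by linarith) ha1]
  have h := integral_one_sub_sq_rpow_le_of_nonneg (by linarith : 0 < m / 2) ha0 ha1
  rw [one_sub_sq_expHeight_rpow_half (by linarith) (by linarith)] at h
  have hi : 0 ≤ ∫ s in a..1, (1 - s ^ 2) ^ (m / 2 - 1) :=
    intervalIntegral.integral_nonneg ha1 fun s hs =>
      one_sub_sq_rpow_nonneg _ ⟨by linarith [hs.1], hs.2⟩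
  have hc : c1 d ≤ m * a := by
    refine (abs_le_of_sq_le_sq' ?_ (by positivity)).2
    have h1 := le_sq_expHeight hm ht
    have h2 : c1 d ^ 2 ≤ m / 6 := sq_c1_le hd
    rw [← ha] at h1
    nlinarith
  calc _ ≤ m * a * ∫ s in a..1, (1 - s ^ 2) ^ (m / 2 - 1) := by gcongr
    _ = 2 * (m / 2) * (a * ∫ s in a..1, (1 - s ^ 2) ^ (m / 2 - 1)) := by ring
    _ ≤ _ := h

theorem le_one_sub_heightCDF_expHeight {d : ℕ} (hd : 2 ≤ d) {t u : ℝ} (ht : 0 ≤ t)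
    (htu : t ≤ u) (hu : 1 ≤ u) :
    (Real.exp (-t) - Real.exp (-u)) / (6 * u) ≤
      1 - heightCDF d (expHeight ((d : ℝ) - 1) t) := by
  have hm := one_le_sub_one hd
  set m : ℝ := (d : ℝ) - 1
  set a := expHeight m t with ha
  set b := expHeight m u with hb
  have ha0 : 0 ≤ a := expHeight_nonneg m t
  have hab : a ≤ b := expHeight_mono (by linarith) htu
  have hb1 : b ≤ 1 := expHeight_le_one m u
  rw [one_sub_heightCDF hd (by linarith) (hab.trans hb1)]
  have h := le_integral_one_sub_sq_rpow (by linarith : 0 < m / 2) ha0 hab hb1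
  rw [one_sub_sq_expHeight_rpow_half (by linarith) ht,
    one_sub_sq_expHeight_rpow_half (by linarith) (by linarith)] at h
  have hi : 0 ≤ ∫ s in a..b, (1 - s ^ 2) ^ (m / 2 - 1) :=
    intervalIntegral.integral_nonneg hab fun s hs =>
      one_sub_sq_rpow_nonneg _ ⟨by linarith [hs.1], by linarith [hs.2]⟩
  have hi2 : 0 ≤ ∫ s in b..1, (1 - s ^ 2) ^ (m / 2 - 1) :=
    intervalIntegral.integral_nonneg hb1 fun s hs =>
      one_sub_sq_rpow_nonneg _ ⟨by linarith [hs.1], by linarith [hs.2]⟩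
  have hadd := intervalIntegral.integral_add_adjacent_intervals
    (intervalIntegrable_one_sub_sq_rpow' (by linarith : 0 < m / 2) (by linarith) hab hb1)
    (intervalIntegrable_one_sub_sq_rpow' (by linarith : 0 < m / 2) (by linarith) hb1 le_rfl)
  have hc0 := c1_pos hd
  have hc : m * b ≤ 6 * u * c1 d := by
    refine (abs_le_of_sq_le_sq' ?_ (by positivity)).2
    have h1 : b ^ 2 ≤ 2 * u / m := sq_expHeight_le (by linarith) (by linarith)
    rw [le_div_iff₀ (by linarith)] at h1
    have h2 : m / 16 ≤ c1 d ^ 2 := le_sq_c1 hd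
    calc (m * b) ^ 2 = m * (b ^ 2 * m) := by ring
      _ ≤ m * (2 * u) := by gcongr
      _ = 32 * u * (m / 16) := by ring
      _ ≤ 36 * u ^ 2 * c1 d ^ 2 := by gcongr ?_ * ?_; nlinarith
      _ = _ := by ring
  rw [← hadd, div_le_iff₀ (by positivity)]
  calc _ ≤ 2 * (m / 2) * (b * ∫ s in a..b, (1 - s ^ 2) ^ (m / 2 - 1)) := h
    _ = m * b * ∫ s in a..b, (1 - s ^ 2) ^ (m / 2 - 1) := by ring
    _ ≤ 6 * u * c1 d * ∫ s in a..b, (1 - s ^ 2) ^ (m / 2 - 1) := by gcongr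
    _ = c1 d * (∫ s in a..b, (1 - s ^ 2) ^ (m / 2 - 1)) * (6 * u) := by ring
    _ ≤ _ := by gcongr; linarith

theorem II_expHeight_one_le (n : ℕ) {d : ℕ} (hd : 2 ≤ d) {t : ℝ} (ht : 0 ≤ t) :
    ((d : ℝ) - 1) ^ 2 * expHeight ((d : ℝ) - 1) t * II n d (expHeight ((d : ℝ) - 1) t) 1 ≤
      Real.exp (-(t * ((d : ℝ) - 1))) := by
  have hm := one_le_sub_one hd
  set m : ℝ := (d : ℝ) - 1 with hmd
  set b := expHeight m t with hb
  have hb0 : 0 ≤ b := expHeight_nonneg m t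
  have hb1 : b ≤ 1 := expHeight_le_one m t
  have h := integral_one_sub_sq_rpow_le_of_nonneg (by positivity : 0 < m ^ 2 / 2) hb0 hb1
  rw [one_sub_sq_expHeight_rpow_sq_half (by linarith) ht] at h
  refine le_trans ?_ h
  have : II n d b 1 ≤ ∫ s in b..1, (1 - s ^ 2) ^ (m ^ 2 / 2 - 1) := by
    rw [II_eq]
    refine intervalIntegral.integral_mono_on hb1
      (intervalIntegrable_heightDensity n hd (by linarith) hb1 le_rfl)
      (intervalIntegrable_one_sub_sq_rpow' (by positivity) (by linarith) hb1 le_rfl)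
      fun s hs => ?_
    have hs' : s ∈ Set.Icc (-1 : ℝ) 1 := ⟨by linarith [hs.1], hs.2⟩
    exact mul_le_of_le_one_right (one_sub_sq_rpow_nonneg _ hs')
      (pow_le_one₀ (heightCDF_nonneg hd hs') (heightCDF_le_one hd hs'))
  calc _ ≤ m ^ 2 * b * ∫ s in b..1, (1 - s ^ 2) ^ (m ^ 2 / 2 - 1) := by gcongr
    _ = _ := by ring

theorem II_neg_one_le (n : ℕ) {d : ℕ} (hd : 2 ≤ d) {g : ℝ} (hg : g ∈ Set.Icc (-1 : ℝ) 1) :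
    II n d (-1) g ≤ 4 * heightCDF d g ^ (n - d) := by
  have hm := one_le_sub_one hd
  have hx : (1 : ℝ) / 2 ≤ ((d : ℝ) - 1) ^ 2 / 2 := by nlinarith
  have hi := intervalIntegrable_one_sub_sq_rpow (by linarith : 0 < ((d : ℝ) - 1) ^ 2 / 2)
  have hig := intervalIntegrable_one_sub_sq_rpow' (by linarith : 0 < ((d : ℝ) - 1) ^ 2 / 2)
    le_rfl hg.1 hg.2
  have hG : 0 ≤ heightCDF d g ^ (n - d) := pow_nonneg (heightCDF_nonneg hd hg) _
  calc II n d (-1) g ≤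
      ∫ s in (-1 : ℝ)..g, (1 - s ^ 2) ^ (((d : ℝ) - 1) ^ 2 / 2 - 1) *
        heightCDF d g ^ (n - d) := by
        rw [II_eq]
        refine intervalIntegral.integral_mono_on hg.1
          (intervalIntegrable_heightDensity n hd le_rfl hg.1 hg.2)
          (hig.mul_const _) fun s hs => ?_
        have hs' : s ∈ Set.Icc (-1 : ℝ) 1 := ⟨hs.1, hs.2.trans hg.2⟩
        exact mul_le_mul_of_nonneg_left
          (pow_le_pow_left₀ (heightCDF_nonneg hd hs') (heightCDF_mono hd hs' hg hs.2) _)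
          (one_sub_sq_rpow_nonneg _ hs')
    _ = (∫ s in (-1 : ℝ)..g, (1 - s ^ 2) ^ (((d : ℝ) - 1) ^ 2 / 2 - 1)) *
        heightCDF d g ^ (n - d) := intervalIntegral.integral_mul_const _ _
    _ ≤ _ := by
        gcongr
        refine le_trans ?_ (integral_one_sub_sq_rpow_le hx)
        refine intervalIntegral.integral_mono_interval le_rfl hg.1 hg.2 ?_ hi
        refine (MeasureTheory.ae_restrict_iff' measurableSet_Ioc).2 (MeasureTheory.ae_of_all _ fun s hs => ?_)
        exact one_sub_sq_rpow_nonneg _ ⟨hs.1.le, hs.2⟩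

theorem exp_neg_le_one_sub_div_pow {n d : ℕ} (hdn : d < n) :
    Real.exp (-(d : ℝ)) ≤ (1 - (d : ℝ) / n) ^ (n - d) := by
  have hN : (0 : ℝ) < ((n - d : ℕ) : ℝ) := by exact_mod_cast Nat.sub_pos_of_lt hdn
  have hcast : ((n - d : ℕ) : ℝ) = n - d := Nat.cast_sub hdn.le
  have hn : (0 : ℝ) < n := by exact_mod_cast (Nat.zero_le d).trans_lt hdn
  have h1 : 1 - (d : ℝ) / n = (1 + (d : ℝ) / ((n - d : ℕ) : ℝ))⁻¹ := by
    rw [hcast] at hN ⊢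
    field_simp
    ring
  have h2 : Real.exp (-((d : ℝ) / ((n - d : ℕ) : ℝ))) ≤ 1 - (d : ℝ) / n := by
    rw [h1, Real.exp_neg]
    gcongr
    linarith [Real.add_one_le_exp ((d : ℝ) / ((n - d : ℕ) : ℝ))]
  calc Real.exp (-(d : ℝ)) = Real.exp (-((d : ℝ) / ((n - d : ℕ) : ℝ))) ^ (n - d) := by
        rw [← Real.exp_nat_mul]
        congr 1
        field_simp
    _ ≤ _ := by gcongr

theorem le_II_expHeight {n d : ℕ} (hd : 2 ≤ d) (hdn : d < n) {t u : ℝ} (ht : 1 ≤ t)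
    (hlog : Real.log ((n : ℝ) / d) ≤ t) (htu : t ≤ u) :
    Real.exp (-(2 * ((d : ℝ) - 1))) *
        (Real.exp (-(t * ((d : ℝ) - 1))) - Real.exp (-(u * ((d : ℝ) - 1)))) ≤
      ((d : ℝ) - 1) ^ 2 * expHeight ((d : ℝ) - 1) u *
        II n d (expHeight ((d : ℝ) - 1) t) (expHeight ((d : ℝ) - 1) u) := by
  have hm := one_le_sub_one hd
  have hd0 : (0 : ℝ) < d := by linarith
  have hn : (0 : ℝ) < n := by exact_mod_cast (Nat.zero_le d).trans_lt hdn
  have hp : Real.exp (-t) ≤ (d : ℝ) / n := by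
    rw [← Real.le_log_iff_exp_le (by positivity), ← inv_div, Real.log_inv]
    linarith
  have hq := exp_neg_le_one_sub_div_pow hdn
  set m : ℝ := (d : ℝ) - 1 with hmd
  set a := expHeight m t with ha
  set b := expHeight m u with hb
  have ha0 : 0 ≤ a := expHeight_nonneg m t
  have hab : a ≤ b := expHeight_mono (by linarith) htu
  have hb1 : b ≤ 1 := expHeight_le_one m u
  have hGa : 1 - (d : ℝ) / n ≤ heightCDF d a := by
    linarith [one_sub_heightCDF_expHeight_le hd ht]
  have hp1 : 0 ≤ 1 - (d : ℝ) / n := by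
    rw [sub_nonneg, div_le_one hn]
    exact_mod_cast hdn.le
  have hE : Real.exp (-(2 * m)) ≤ heightCDF d a ^ (n - d) := by
    calc Real.exp (-(2 * m)) ≤ Real.exp (-(d : ℝ)) := by gcongr; linarith
      _ ≤ _ := hq
      _ ≤ _ := by gcongr
  have h := le_integral_one_sub_sq_rpow (by positivity : 0 < m ^ 2 / 2) ha0 hab hb1
  rw [one_sub_sq_expHeight_rpow_sq_half (by linarith) (by linarith),
    one_sub_sq_expHeight_rpow_sq_half (by linarith) (by linarith)] at h
  have hI : Real.exp (-(2 * m)) * (∫ s in a..b, (1 - s ^ 2) ^ (m ^ 2 / 2 - 1)) ≤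
      II n d a b := by
    rw [II_eq, ← intervalIntegral.integral_const_mul]
    refine intervalIntegral.integral_mono_on hab
      ((intervalIntegrable_one_sub_sq_rpow' (by positivity) (by linarith) hab hb1).const_mul _)
      (intervalIntegrable_heightDensity n hd (by linarith) hab hb1)
      fun s hs => ?_
    have hs' : s ∈ Set.Icc (-1 : ℝ) 1 := ⟨by linarith [hs.1], by linarith [hs.2]⟩
    rw [heightDensity, mul_comm]
    refine mul_le_mul_of_nonneg_left (hE.trans ?_) (one_sub_sq_rpow_nonneg _ hs')
    have ha' := expHeight_mem_Icc m t
    exact pow_le_pow_left₀ (heightCDF_nonneg hd ha') (heightCDF_mono hd ha' hs' hs.1) _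
  calc _ ≤ Real.exp (-(2 * m)) *
        (2 * (m ^ 2 / 2) * (b * ∫ s in a..b, (1 - s ^ 2) ^ (m ^ 2 / 2 - 1))) := by gcongr
    _ = m ^ 2 * b *
        (Real.exp (-(2 * m)) * ∫ s in a..b, (1 - s ^ 2) ^ (m ^ 2 / 2 - 1)) := by ring
    _ ≤ _ := by
      have : 0 ≤ b := ha0.trans hab
      gcongr

theorem II_neg_one_expHeight_le {n d : ℕ} (hd : 2 ≤ d) (hdn : 2 * d ≤ n) {δ : ℝ} (hδ : 0 ≤ δ)
    (hδ1 : δ ≤ 1) (hlog : 1 ≤ Real.log ((n : ℝ) / d)) :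
    II n d (-1) (expHeight ((d : ℝ) - 1) ((1 - δ) * Real.log ((n : ℝ) / d))) ≤
      4 * Real.exp (-(((d : ℝ) - 1) * ((Real.exp (δ * Real.log ((n : ℝ) / d)) - 1) /
        (12 * Real.log ((n : ℝ) / d))))) := by
  have hm := one_le_sub_one hd
  have hd0 : (0 : ℝ) < d := by linarith
  have hn : (0 : ℝ) < n := by exact_mod_cast (by omega : 0 < n)
  set Λ := Real.log ((n : ℝ) / d) with hΛ
  have hp : Real.exp (-Λ) = (d : ℝ) / n := by
    rw [Real.exp_neg, hΛ, Real.exp_log (by positivity), inv_div]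
  set m : ℝ := (d : ℝ) - 1 with hmd
  have hg := expHeight_mem_Icc m ((1 - δ) * Λ)
  refine (II_neg_one_le n hd hg).trans ?_
  have hT := le_one_sub_heightCDF_expHeight hd
    (mul_nonneg (by linarith) (by linarith) : 0 ≤ (1 - δ) * Λ) (by nlinarith) hlog
  have hG0 := heightCDF_nonneg hd hg
  set G := heightCDF d (expHeight m ((1 - δ) * Λ))
  have he : Real.exp (-((1 - δ) * Λ)) = (d : ℝ) / n * Real.exp (δ * Λ) := by
    rw [← hp, ← Real.exp_add]
    congr 1
    ring
  rw [he, hp] at hT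
  gcongr
  have hGe : G ≤ Real.exp (-(1 - G)) := by linarith [Real.add_one_le_exp (-(1 - G))]
  have hN : (n : ℝ) / 2 ≤ ((n - d : ℕ) : ℝ) := by
    rw [Nat.cast_sub (by omega)]
    have : (2 * d : ℝ) ≤ n := by exact_mod_cast hdn
    linarith
  have hexp : 0 ≤ Real.exp (δ * Λ) - 1 := by
    linarith [Real.add_one_le_exp (δ * Λ), mul_nonneg hδ (by linarith : 0 ≤ Λ)]
  calc G ^ (n - d) ≤ Real.exp (-(1 - G)) ^ (n - d) := by gcongr
    _ = Real.exp (-((n - d : ℕ) * (1 - G))) := by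
      rw [← Real.exp_nat_mul, mul_neg]
    _ ≤ _ := by
      rw [Real.exp_le_exp, neg_le_neg_iff]
      have hT2 : 0 ≤ (↑d / ↑n * Real.exp (δ * Λ) - ↑d / ↑n) / (6 * Λ) := by
        have : (d : ℝ) / n * Real.exp (δ * Λ) - d / n = d / n * (Real.exp (δ * Λ) - 1) := by
          ring
        rw [this]
        positivity
      calc m * ((Real.exp (δ * Λ) - 1) / (12 * Λ))
          ≤ d * ((Real.exp (δ * Λ) - 1) / (12 * Λ)) := by gcongr; linarith
        _ = n / 2 * ((↑d / ↑n * Real.exp (δ * Λ) - ↑d / ↑n) / (6 * Λ)) := by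
          field_simp
          ring
        _ ≤ (n - d : ℕ) * (1 - G) := by gcongr

theorem eventually_poly_le_exp {δ : ℝ} (hδ : 0 < δ) (K : ℝ) :
    ∀ᶠ Λ in atTop, K + 2 * Λ ≤ (Real.exp (δ * Λ) - 1) / (12 * Λ) := by
  have h := (isLittleO_pow_exp_pos_mul_atTop 2 hδ).bound
    (by positivity : (0 : ℝ) < (12 * (|K| + 2) + 1)⁻¹)
  filter_upwards [h, eventually_ge_atTop 1] with Λ h h1
  have hC : (0 : ℝ) < 12 * (|K| + 2) + 1 := by positivity
  rw [Real.norm_of_nonneg (by positivity), Real.norm_of_nonneg (by positivity),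
    inv_mul_eq_div, le_div_iff₀ hC] at h
  rw [le_div_iff₀ (by positivity)]
  nlinarith [le_abs_self K, abs_nonneg K, mul_nonneg (abs_nonneg K) (by nlinarith : 0 ≤ Λ ^ 2 - Λ),
    mul_nonneg (by linarith [le_abs_self K] : 0 ≤ |K| - K) (by linarith : 0 ≤ Λ)]

theorem eventually_exp_tail_le {δ η : ℝ} (hδ : 0 < δ) (hη : 0 < η) (hη1 : η ≤ 1) :
    ∀ᶠ Λ in atTop, ∀ m : ℝ, 1 ≤ m →
      Real.exp (-((1 + δ) * Λ * m)) ≤ η * (Real.exp (-(2 * m)) *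
        (Real.exp (-((1 + δ / 2) * Λ * m)) - Real.exp (-((1 + δ) * Λ * m)))) := by
  filter_upwards [eventually_ge_atTop ((3 - Real.log η) / (δ / 2))] with Λ hΛ m hm
  rw [div_le_iff₀ (by positivity)] at hΛ
  have hlog : Real.log η ≤ 0 := Real.log_nonpos hη.le hη1
  have h1 : Real.exp (-((1 + δ / 2) * Λ * m)) =
      Real.exp (-((1 + δ) * Λ * m)) * Real.exp (Λ * (δ / 2) * m) := by
    rw [← Real.exp_add]; congr 1; ring
  have h2 : Real.exp (3 * m) ≤ η * Real.exp (Λ * (δ / 2) * m) := by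
    have h : Real.exp (3 * m) ≤ Real.exp (Real.log η) * Real.exp (Λ * (δ / 2) * m) := by
      rw [← Real.exp_add, Real.exp_le_exp]
      nlinarith
    rwa [Real.exp_log hη] at h
  have h3 : Real.exp (2 * m) + 1 ≤ Real.exp (3 * m) := by
    have e : Real.exp (3 * m) = Real.exp (2 * m) * Real.exp m := by
      rw [← Real.exp_add]; congr 1; ring
    rw [e]
    nlinarith [Real.add_one_le_exp m, Real.add_one_le_exp (2 * m)]
  have h4 : 1 ≤ η * (Real.exp (-(2 * m)) * (Real.exp (Λ * (δ / 2) * m) - 1)) := by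
    rw [Real.exp_neg, mul_left_comm, inv_mul_eq_div, le_div_iff₀ (Real.exp_pos _)]
    nlinarith
  calc _ = Real.exp (-((1 + δ) * Λ * m)) * 1 := (mul_one _).symm
    _ ≤ Real.exp (-((1 + δ) * Λ * m)) *
        (η * (Real.exp (-(2 * m)) * (Real.exp (Λ * (δ / 2) * m) - 1))) := by gcongr
    _ = _ := by rw [h1]; ring

theorem eventually_exp_bulk_le {δ η : ℝ} (hδ : 0 < δ) (hδ1 : δ ≤ 1) (hη : 0 < η) (hη1 : η ≤ 1) :
    ∀ᶠ Λ in atTop, ∀ m : ℝ, 1 ≤ m →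
      m ^ 2 * (4 * Real.exp (-(m * ((Real.exp (δ * Λ) - 1) / (12 * Λ))))) ≤
        η * (Real.exp (-(2 * m)) *
          (Real.exp (-((1 + δ / 2) * Λ * m)) - Real.exp (-((1 + δ) * Λ * m)))) := by
  filter_upwards [eventually_ge_atTop (1 / (δ / 2)),
    eventually_poly_le_exp hδ (6 - Real.log η)] with Λ hΛ hE m hm
  have hΛ0 : 0 ≤ Λ := le_trans (by positivity) hΛ
  rw [div_le_iff₀ (by positivity)] at hΛ
  have hlog : Real.log η ≤ 0 := Real.log_nonpos hη.le hη1
  have h1 : Real.exp (-((1 + δ / 2) * Λ * m)) =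
      Real.exp (-((1 + δ) * Λ * m)) * Real.exp (Λ * (δ / 2) * m) := by
    rw [← Real.exp_add]; congr 1; ring
  have h2 : 1 ≤ Real.exp (Λ * (δ / 2) * m) - 1 := by
    nlinarith [Real.add_one_le_exp (Λ * (δ / 2) * m)]
  have h3 : Real.exp (-(2 * Λ * m)) ≤
      Real.exp (-((1 + δ / 2) * Λ * m)) - Real.exp (-((1 + δ) * Λ * m)) := by
    calc Real.exp (-(2 * Λ * m)) ≤ Real.exp (-((1 + δ) * Λ * m)) * 1 := by
          rw [mul_one, Real.exp_le_exp]
          nlinarith [mul_nonneg (mul_nonneg hΛ0 (by linarith : 0 ≤ m))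
            (by linarith : 0 ≤ 1 - δ)]
      _ ≤ Real.exp (-((1 + δ) * Λ * m)) * (Real.exp (Λ * (δ / 2) * m) - 1) := by gcongr
      _ = _ := by rw [h1]; ring
  have h4 : m ^ 2 * 4 ≤ Real.exp (4 * m) := by
    have e : Real.exp (4 * m) = (Real.exp m * Real.exp m) ^ 2 := by
      rw [← Real.exp_add, ← Real.exp_nat_mul]; congr 1; push_cast; ring
    have : m * 2 ≤ Real.exp m * Real.exp m := by
      nlinarith [Real.add_one_le_exp m]
    rw [e]
    nlinarith
  calc _ = m ^ 2 * 4 * Real.exp (-(m * ((Real.exp (δ * Λ) - 1) / (12 * Λ)))) := by ring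
    _ ≤ Real.exp (4 * m) * Real.exp (-(m * (6 - Real.log η + 2 * Λ))) := by gcongr
    _ ≤ Real.exp (Real.log η) * (Real.exp (-(2 * m)) * Real.exp (-(2 * Λ * m))) := by
      rw [← Real.exp_add, ← Real.exp_add, ← Real.exp_add, Real.exp_le_exp]
      nlinarith
    _ ≤ _ := by
      rw [Real.exp_log hη]
      gcongr

theorem eventually_II_le {δ η : ℝ} (hδ : 0 < δ) (hδ1 : δ < 1) (hη : 0 < η) (hη1 : η ≤ 1) :
    ∀ᶠ Λ in atTop, ∀ n d : ℕ, 2 ≤ d → d < n → Real.log ((n : ℝ) / d) = Λ →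
      0 < II n d (-1) 1 ∧
      (1 - 2 * η) * II n d (-1) 1 ≤ II n d (expHeight ((d : ℝ) - 1) ((1 - δ) * Λ))
        (expHeight ((d : ℝ) - 1) ((1 + δ) * Λ)) := by
  filter_upwards [eventually_exp_tail_le hδ hη hη1, eventually_exp_bulk_le hδ hδ1.le hη hη1,
    eventually_ge_atTop 1] with Λ hT hB hΛ n d hd hdn hlog
  have hm := one_le_sub_one hd
  have hd0 : (0 : ℝ) < d := by linarith
  have hn : (0 : ℝ) < n := by exact_mod_cast (Nat.zero_le d).trans_lt hdn
  have h2dn : 2 * d ≤ n := by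
    have h1 : Real.exp 1 ≤ (n : ℝ) / d := by
      rw [← Real.le_log_iff_exp_le (by positivity)]
      linarith
    have h2 : (2 : ℝ) ≤ n / d := by linarith [Real.add_one_le_exp 1]
    rw [le_div_iff₀ hd0] at h2
    exact_mod_cast h2
  have hbulk := II_neg_one_expHeight_le hd h2dn hδ.le hδ1.le (by linarith)
  have htail := II_expHeight_one_le n hd (by nlinarith : 0 ≤ (1 + δ) * Λ)
  have hgood := le_II_expHeight hd hdn (by nlinarith : 1 ≤ (1 + δ / 2) * Λ)
    (by nlinarith) (by nlinarith : (1 + δ / 2) * Λ ≤ (1 + δ) * Λ)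
  rw [hlog] at hbulk
  specialize hT _ hm
  specialize hB _ hm
  set m : ℝ := (d : ℝ) - 1 with hmd
  have hg0 := expHeight_nonneg m ((1 - δ) * Λ)
  have hga : expHeight m ((1 - δ) * Λ) ≤ expHeight m ((1 + δ / 2) * Λ) :=
    expHeight_mono (by linarith) (by nlinarith)
  have hab : expHeight m ((1 + δ / 2) * Λ) ≤ expHeight m ((1 + δ) * Λ) :=
    expHeight_mono (by linarith) (by nlinarith)
  have hb1 := expHeight_le_one m ((1 + δ) * Λ)
  have hb0 : 0 < expHeight m ((1 + δ) * Λ) := by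
    have := le_sq_expHeight hm (by nlinarith : 1 ≤ (1 + δ) * Λ)
    refine lt_of_le_of_ne (expHeight_nonneg _ _) fun h => ?_
    rw [← h] at this
    norm_num at this
  set g := expHeight m ((1 - δ) * Λ)
  set a := expHeight m ((1 + δ / 2) * Λ)
  set b := expHeight m ((1 + δ) * Λ)
  set E := Real.exp (-(2 * m)) *
    (Real.exp (-((1 + δ / 2) * Λ * m)) - Real.exp (-((1 + δ) * Λ * m)))
  have hmono : II n d a b ≤ II n d g b := II_mono n hd (by linarith) hga hab le_rfl hb1
  have hE : 0 < E := pos_of_mul_pos_right ((Real.exp_pos _).trans_le hT) hη.le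
  have hM : 0 < II n d a b :=
    pos_of_mul_pos_right (hE.trans_le hgood) (by positivity)
  have h1 : II n d b 1 ≤ η * II n d a b := by
    refine le_of_mul_le_mul_left (a := m ^ 2 * b) ?_ (by positivity)
    calc _ ≤ η * E := htail.trans hT
      _ ≤ η * (m ^ 2 * b * II n d a b) := by gcongr
      _ = _ := by ring
  have h2 : II n d (-1) g ≤ η * II n d a b := by
    refine le_of_mul_le_mul_left (a := m ^ 2) ?_ (by positivity)
    calc _ ≤ η * E := (mul_le_mul_of_nonneg_left hbulk (by positivity)).trans hB
      _ ≤ η * (m ^ 2 * b * II n d a b) := by gcongr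
      _ ≤ η * (m ^ 2 * 1 * II n d a b) := by gcongr
      _ = _ := by ring
  have hsum1 := II_add n hd le_rfl (by linarith : (-1 : ℝ) ≤ g) (hga.trans hab) hb1
  have hsum2 := II_add n hd le_rfl (by linarith : (-1 : ℝ) ≤ b) hb1 le_rfl
  have h0 : 0 ≤ II n d (-1) g :=
    II_nonneg n hd le_rfl (by linarith) ((hga.trans hab).trans hb1)
  have h0' : 0 ≤ II n d b 1 := II_nonneg n hd (by linarith) hb1 le_rfl
  refine ⟨by linarith, ?_⟩
  nlinarith

theorem tendsto_log_div_atTop {d : ℕ → ℕ} (hd : ∀ᶠ n in atTop, 2 ≤ d n ∧ d n < n)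
    (hdn : Tendsto (fun n : ℕ => (d n : ℝ) / (n : ℝ)) atTop (nhds 0)) :
    Tendsto (fun n : ℕ => Real.log ((n : ℝ) / d n)) atTop atTop := by
  refine Real.tendsto_log_atTop.comp ?_
  have h : Tendsto (fun n : ℕ => (d n : ℝ) / (n : ℝ)) atTop (nhdsWithin 0 (Set.Ioi 0)) := by
    refine tendsto_nhdsWithin_iff.2 ⟨hdn, ?_⟩
    filter_upwards [hd] with n hn
    have h1 : (0 : ℝ) < d n := by exact_mod_cast (by omega : 0 < d n)
    have h2 : (0 : ℝ) < n := by exact_mod_cast (by omega : 0 < n)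
    exact div_pos h1 h2
  exact h.inv_tendsto_nhdsGT_zero.congr fun n => inv_div _ _

/-- The height measure concentrates between the heights `expHeight (d - 1) ((1 ± δ) log (n / d))`. -/
theorem tendsto_div_II_one {d : ℕ → ℕ} (hd : ∀ᶠ n in atTop, 2 ≤ d n ∧ d n < n)
    (hdn : Tendsto (fun n : ℕ => (d n : ℝ) / (n : ℝ)) atTop (nhds 0)) {δ : ℝ} (hδ : 0 < δ)
    (hδ1 : δ < 1) {J : ℕ → ℝ}
    (hJ : ∀ᶠ n in atTop, II n (d n)
        (expHeight ((d n : ℝ) - 1) ((1 - δ) * Real.log ((n : ℝ) / d n)))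
        (expHeight ((d n : ℝ) - 1) ((1 + δ) * Real.log ((n : ℝ) / d n))) ≤ J n ∧
      J n ≤ II n (d n) (-1) 1) :
    Tendsto (fun n => J n / II n (d n) (-1) 1) atTop (nhds 1) := by
  rw [Metric.tendsto_nhds]
  intro e he
  have hΛ := tendsto_log_div_atTop hd hdn
  have hη : 0 < min 1 (e / 4) := by positivity
  filter_upwards [hd, hJ, hΛ.eventually (eventually_II_le hδ hδ1 hη (min_le_left _ _))]
    with n hn hJn hI
  obtain ⟨hpos, hI⟩ := hI n (d n) hn.1 hn.2 rfl
  have h1 : 1 - 2 * min 1 (e / 4) ≤ J n / II n (d n) (-1) 1 := by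
    rw [le_div_iff₀ hpos]
    exact hI.trans hJn.1
  have h2 : J n / II n (d n) (-1) 1 ≤ 1 := (div_le_one hpos).2 hJn.2
  rw [Real.dist_eq, abs_sub_lt_iff]
  have := min_le_right 1 (e / 4)
  constructor <;> linarith

theorem tendsto_II_div_II_one {d : ℕ → ℕ} (hd : ∀ᶠ n in atTop, 2 ≤ d n ∧ d n < n)
    (hdn : Tendsto (fun n : ℕ => (d n : ℝ) / (n : ℝ)) atTop (nhds 0)) {δ : ℝ} (hδ : 0 < δ)
    (hδ1 : δ < 1) {a b : ℕ → ℝ}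
    (hab : ∀ᶠ n in atTop, -1 ≤ a n ∧
      a n ≤ expHeight ((d n : ℝ) - 1) ((1 - δ) * Real.log ((n : ℝ) / d n)) ∧
      expHeight ((d n : ℝ) - 1) ((1 + δ) * Real.log ((n : ℝ) / d n)) ≤ b n ∧ b n ≤ 1) :
    Tendsto (fun n => II n (d n) (a n) (b n) / II n (d n) (-1) 1) atTop (nhds 1) := by
  refine tendsto_div_II_one hd hdn hδ hδ1 ?_
  filter_upwards [hd, hab, (tendsto_log_div_atTop hd hdn).eventually_ge_atTop 0]
    with n hn ⟨ha1, ha, hb, hb1⟩ hΛ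
  have hm := one_le_sub_one hn.1
  have hgb : expHeight ((d n : ℝ) - 1) ((1 - δ) * Real.log ((n : ℝ) / d n)) ≤
      expHeight ((d n : ℝ) - 1) ((1 + δ) * Real.log ((n : ℝ) / d n)) :=
    expHeight_mono (by linarith) (by nlinarith)
  exact ⟨II_mono n hn.1 ha1 ha hgb hb hb1,
    II_mono n hn.1 le_rfl ha1 ((ha.trans hgb).trans hb) hb1 le_rfl⟩

theorem typical_height_subexponential {d : ℕ → ℕ} (hd : ∀ᶠ n in atTop, 2 ≤ d n ∧ d n < n)
    (hdn : Tendsto (fun n : ℕ => (d n : ℝ) / (n : ℝ)) atTop (nhds 0))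
    (hdtop : Tendsto (fun n : ℕ => (d n : ℝ)) atTop atTop)
    (hlog : Tendsto (fun n : ℕ => Real.log n / (d n : ℝ)) atTop (nhds 0))
    {ε : ℝ} (hε : 0 < ε) (hε2 : ε < √2) :
    Tendsto (fun n : ℕ =>
        II n (d n)
          ((√2 - ε) * √(Real.log ((n : ℝ) / (d n : ℝ)) / (d n : ℝ)))
          ((√2 + ε) * √(Real.log ((n : ℝ) / (d n : ℝ)) / (d n : ℝ))) /
        II n (d n) (-1) 1) atTop (nhds 1) := by
  have h2 : √2 ^ 2 = 2 := Real.sq_sqrt (by norm_num)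
  obtain ⟨δ, hδ, hδ1, hA, hB⟩ : ∃ δ : ℝ, 0 < δ ∧ δ < 1 ∧ (√2 - ε) ^ 2 < 2 * (1 - δ) ∧
      2 * (1 + δ) < (√2 + ε) ^ 2 := by
    have hA : (√2 - ε) ^ 2 < 2 := by nlinarith
    have hB : 2 < (√2 + ε) ^ 2 := by nlinarith [Real.sqrt_nonneg 2]
    have hδ := min_le_left ((2 - (√2 - ε) ^ 2) / 4) (((√2 + ε) ^ 2 - 2) / 4)
    have hδ' := min_le_right ((2 - (√2 - ε) ^ 2) / 4) (((√2 + ε) ^ 2 - 2) / 4)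
    refine ⟨min ((2 - (√2 - ε) ^ 2) / 4) (((√2 + ε) ^ 2 - 2) / 4),
      lt_min (by linarith) (by linarith), ?_, ?_, ?_⟩ <;> nlinarith [sq_nonneg (√2 - ε)]
  have hΛ := tendsto_log_div_atTop hd hdn
  have hΛd : Tendsto (fun n : ℕ => Real.log ((n : ℝ) / d n) / d n) atTop (nhds 0) := by
    refine tendsto_of_tendsto_of_tendsto_of_le_of_le' tendsto_const_nhds hlog ?_ ?_
    · filter_upwards [hΛ.eventually_ge_atTop 0] with n hn
      positivity
    · filter_upwards [hd] with n hn
      have h1 : (1 : ℝ) ≤ d n := by exact_mod_cast (by omega : 1 ≤ d n)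
      have h2 : (0 : ℝ) < n := by exact_mod_cast (by omega : 0 < n)
      gcongr
      exact div_le_self h2.le h1
  have hsmall : ∀ c : ℝ, 0 < c → ∀ᶠ n : ℕ in atTop, Real.log ((n : ℝ) / d n) / d n < c :=
    fun c hc => hΛd.eventually_lt_const hc
  refine tendsto_II_div_II_one hd hdn hδ hδ1 ?_
  filter_upwards [hd, hΛ.eventually_ge_atTop 0,
    hsmall ((2 * (1 - δ) - (√2 - ε) ^ 2) / 8) (by linarith),
    hsmall (((√2 + ε) ^ 2)⁻¹) (by positivity),
    hdtop.eventually_ge_atTop ((√2 + ε) ^ 2 / ((√2 + ε) ^ 2 - 2 * (1 + δ)))]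
    with n hn hΛ0 hs1 hs2 hdl
  have hm := one_le_sub_one hn.1
  have hd0 : (0 : ℝ) < d n := by linarith
  set Λ := Real.log ((n : ℝ) / d n)
  set m : ℝ := (d n : ℝ) - 1 with hmd
  have hsq : √(Λ / d n) ^ 2 = Λ / d n := Real.sq_sqrt (by positivity)
  have ha0 : 0 ≤ (√2 - ε) * √(Λ / d n) := mul_nonneg (by linarith) (Real.sqrt_nonneg _)
  have ht0 : 0 ≤ (1 - δ) * Λ := mul_nonneg (by linarith) hΛ0
  refine ⟨by linarith, ?_, ?_, ?_⟩
  · refine (abs_le_of_sq_le_sq' ?_ (expHeight_nonneg _ _)).2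
    rw [sq_expHeight (by linarith) ht0, mul_pow, hsq, neg_div]
    have hx0 : 0 ≤ 2 * ((1 - δ) * Λ) / m := by positivity
    refine le_trans ?_ (div_one_add_le_one_sub_exp_neg hx0)
    rw [le_div_iff₀ (by positivity)]
    have hmd2 : Λ / m ≤ 2 * (Λ / d n) := by
      rw [← mul_div_assoc, div_le_div_iff₀ (by linarith) hd0]
      nlinarith
    have hdm : Λ / d n ≤ Λ / m := by
      gcongr
      linarith
    have e : 2 * ((1 - δ) * Λ) / m = 2 * (1 - δ) * (Λ / m) := by ring
    have hy : 0 ≤ Λ / m := by positivity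
    have hle : (√2 - ε) ^ 2 * (1 + 2 * ((1 - δ) * Λ) / m) ≤ 2 * (1 - δ) := by
      have h3 : 2 * ((1 - δ) * Λ) / m ≤ (2 * (1 - δ) - (√2 - ε) ^ 2) / 2 := by
        rw [e]
        nlinarith
      nlinarith [sq_nonneg (√2 - ε)]
    calc _ = (√2 - ε) ^ 2 * (1 + 2 * ((1 - δ) * Λ) / m) * (Λ / d n) := by ring
      _ ≤ 2 * (1 - δ) * (Λ / d n) := by gcongr
      _ ≤ 2 * (1 - δ) * (Λ / m) := by
        have : 0 ≤ 1 - δ := by linarith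
        gcongr
      _ = _ := e.symm
  · refine (abs_le_of_sq_le_sq' ?_ (by positivity)).2
    refine (sq_expHeight_le (by linarith) (by positivity)).trans ?_
    rw [mul_pow, hsq]
    rw [div_le_iff₀ (by linarith)] at hdl
    rw [← mul_div_assoc, div_le_div_iff₀ (by linarith) hd0]
    have : 2 * (1 + δ) * d n ≤ (√2 + ε) ^ 2 * m := by rw [hmd]; nlinarith
    nlinarith
  · refine (abs_le_of_sq_le_sq' ?_ zero_le_one).2
    rw [mul_pow, hsq]
    have hB0 : 0 < (√2 + ε) ^ 2 := by positivity
    calc _ ≤ (√2 + ε) ^ 2 * ((√2 + ε) ^ 2)⁻¹ := by gcongr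
      _ = 1 ^ 2 := by rw [mul_inv_cancel₀ hB0.ne', one_pow]

theorem typical_height_exponential {d : ℕ → ℕ} (hd : ∀ᶠ n in atTop, 2 ≤ d n ∧ d n < n)
    (hdn : Tendsto (fun n : ℕ => (d n : ℝ) / (n : ℝ)) atTop (nhds 0))
    {ρ : ℝ} (hρ : 0 < ρ)
    (hlog : Tendsto (fun n : ℕ => Real.log n / (d n : ℝ)) atTop (nhds ρ))
    {ε : ℝ} (hε : 0 < ε) (hε2 : ε < √(1 - Real.exp (-2 * ρ))) :
    Tendsto (fun n : ℕ =>
        II n (d n) (√(1 - Real.exp (-2 * ρ)) - ε) (min (√(1 - Real.exp (-2 * ρ)) + ε) 1) /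
        II n (d n) (-1) 1) atTop (nhds 1) := by
  have hlogn : Tendsto (fun n : ℕ => Real.log n) atTop atTop :=
    Real.tendsto_log_atTop.comp tendsto_natCast_atTop_atTop
  have hdtop : Tendsto (fun n : ℕ => (d n : ℝ)) atTop atTop := by
    have h := hlogn.atTop_mul_pos (inv_pos.2 hρ) (hlog.inv₀ hρ.ne')
    refine h.congr' ?_
    filter_upwards [hlogn.eventually_gt_atTop 0] with n hn
    rw [inv_div]
    field_simp
  have hΛm : Tendsto (fun n : ℕ => Real.log ((n : ℝ) / d n) / ((d n : ℝ) - 1)) atTop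
      (nhds ρ) := by
    have h1 : Tendsto (fun n : ℕ => Real.log (d n) / (d n : ℝ)) atTop (nhds 0) :=
      Real.isLittleO_log_id_atTop.tendsto_div_nhds_zero.comp hdtop
    have h2 : Tendsto (fun n : ℕ => (1 - (d n : ℝ)⁻¹)⁻¹) atTop (nhds ((1 - 0)⁻¹)) :=
      (tendsto_const_nhds.sub hdtop.inv_tendsto_atTop).inv₀ (by norm_num)
    have h3 := (hlog.sub h1).mul h2
    simp only [sub_zero, inv_one, mul_one] at h3
    refine h3.congr' ?_
    filter_upwards [hd] with n hn
    have hm := one_le_sub_one hn.1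
    have hd0 : (0 : ℝ) < d n := by linarith
    have hn0 : (0 : ℝ) < n := by exact_mod_cast (by omega : 0 < n)
    have hm' : (d n : ℝ) - 1 ≠ 0 := by linarith
    rw [Real.log_div hn0.ne' hd0.ne']
    field_simp
  have hlim : ∀ s : ℝ, Tendsto (fun n : ℕ => expHeight ((d n : ℝ) - 1)
      (s * Real.log ((n : ℝ) / d n))) atTop (nhds (√(1 - Real.exp (-(2 * (s * ρ)))))) := by
    intro s
    have hc : Continuous fun y : ℝ => √(1 - Real.exp (-(2 * (s * y)))) := by fun_prop
    refine ((hc.tendsto ρ).comp hΛm).congr fun n => ?_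
    simp only [Function.comp_apply, expHeight]
    congr 3
    ring
  have h1 : √(1 - Real.exp (-(2 * (1 * ρ)))) = √(1 - Real.exp (-2 * ρ)) := by ring_nf
  have hlow : Tendsto (fun δ : ℝ => √(1 - Real.exp (-(2 * ((1 - δ) * ρ))))) (nhds 0)
      (nhds (√(1 - Real.exp (-2 * ρ)))) := by
    have := (by fun_prop : Continuous fun δ : ℝ =>
      √(1 - Real.exp (-(2 * ((1 - δ) * ρ))))).tendsto 0
    simpa only [sub_zero, h1] using this
  have hupp : Tendsto (fun δ : ℝ => √(1 - Real.exp (-(2 * ((1 + δ) * ρ))))) (nhds 0)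
      (nhds (√(1 - Real.exp (-2 * ρ)))) := by
    have := (by fun_prop : Continuous fun δ : ℝ =>
      √(1 - Real.exp (-(2 * ((1 + δ) * ρ))))).tendsto 0
    simpa only [add_zero, h1] using this
  obtain ⟨δ, ⟨⟨hδl, hδu⟩, hδ1⟩, hδ⟩ :=
    (((((hlow.eventually_const_lt (sub_lt_self _ hε)).and
      (hupp.eventually_lt_const (lt_add_of_pos_right _ hε))).and
      (eventually_lt_nhds (zero_lt_one' ℝ))).filter_mono nhdsWithin_le_nhds).and
      (self_mem_nhdsWithin : Set.Ioi (0 : ℝ) ∈ nhdsWithin 0 (Set.Ioi 0))).exists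
  refine tendsto_II_div_II_one hd hdn hδ hδ1 ?_
  filter_upwards [(hlim (1 - δ)).eventually_const_lt hδl,
    (hlim (1 + δ)).eventually_lt_const hδu] with n hl hu
  exact ⟨by linarith, hl.le, le_min hu.le (expHeight_le_one _ _), min_le_right _ _⟩

theorem sqrt_one_sub_rpow_eq_expHeight {n : ℕ} (hn : 0 < n) (s m : ℝ) :
    √(1 - (n : ℝ) ^ (-s / m)) = expHeight m (s / 2 * Real.log n) := by
  have hn0 : (0 : ℝ) < n := by exact_mod_cast hn
  rw [expHeight, Real.rpow_def_of_pos hn0]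
  congr 3
  ring

theorem typical_height_superexponential {d : ℕ → ℕ} (hd : ∀ᶠ n in atTop, 2 ≤ d n ∧ d n < n)
    (hdn : Tendsto (fun n : ℕ => (d n : ℝ) / (n : ℝ)) atTop (nhds 0))
    (hlog : Tendsto (fun n : ℕ => Real.log n / (d n : ℝ)) atTop atTop)
    {ε : ℝ} (hε : 0 < ε) (hε2 : ε < 2) :
    Tendsto (fun n : ℕ =>
        (II n (d n) (√(1 - (n : ℝ) ^ (-(2 - ε) / ((d n : ℝ) - 1))))
            (√(1 - (n : ℝ) ^ (-(2 + ε) / ((d n : ℝ) - 1)))) +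
          II n (d n) (-(√(1 - (n : ℝ) ^ (-(2 + ε) / ((d n : ℝ) - 1)))))
            (-(√(1 - (n : ℝ) ^ (-(2 - ε) / ((d n : ℝ) - 1)))))) /
        II n (d n) (-1) 1) atTop (nhds 1) := by
  refine tendsto_div_II_one hd hdn (by linarith : 0 < ε / 4) (by linarith) ?_
  filter_upwards [hd, (tendsto_log_div_atTop hd hdn).eventually_ge_atTop 0,
    hlog.eventually_ge_atTop (4 / ε)] with n hn hΛ hl
  have hm := one_le_sub_one hn.1
  have hd0 : (0 : ℝ) < d n := by linarith
  have hn0 : (0 : ℝ) < n := by exact_mod_cast (by omega : 0 < n)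
  rw [sqrt_one_sub_rpow_eq_expHeight (by omega), sqrt_one_sub_rpow_eq_expHeight (by omega)]
  rw [Real.log_div hn0.ne' hd0.ne'] at hΛ ⊢
  rw [div_le_div_iff₀ hε hd0] at hl
  have hlogd : Real.log (d n) ≤ d n := (Real.log_le_sub_one_of_pos hd0).trans (by linarith)
  have hlogd0 : 0 ≤ Real.log (d n) := Real.log_nonneg (by linarith)
  set m : ℝ := (d n : ℝ) - 1
  have hga : expHeight m ((2 - ε) / 2 * Real.log n) ≤
      expHeight m ((1 - ε / 4) * (Real.log n - Real.log (d n))) :=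
    expHeight_mono (by linarith) (by nlinarith)
  have hgb : expHeight m ((1 - ε / 4) * (Real.log n - Real.log (d n))) ≤
      expHeight m ((1 + ε / 4) * (Real.log n - Real.log (d n))) :=
    expHeight_mono (by linarith) (by nlinarith)
  have hbb : expHeight m ((1 + ε / 4) * (Real.log n - Real.log (d n))) ≤
      expHeight m ((2 + ε) / 2 * Real.log n) :=
    expHeight_mono (by linarith) (by nlinarith)
  have ha0 := expHeight_nonneg m ((2 - ε) / 2 * Real.log n)
  have hb1 := expHeight_le_one m ((2 + ε) / 2 * Real.log n)
  set a := expHeight m ((2 - ε) / 2 * Real.log n)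
  set b := expHeight m ((2 + ε) / 2 * Real.log n)
  have hab : a ≤ b := (hga.trans hgb).trans hbb
  have hM := II_mono n hn.1 (by linarith : -1 ≤ a) hga hgb hbb hb1
  have hneg : 0 ≤ II n (d n) (-b) (-a) :=
    II_nonneg n hn.1 (by linarith) (by linarith) (by linarith)
  have h1 : II n (d n) (-b) (-a) ≤ II n (d n) (-1) 0 :=
    II_mono n hn.1 le_rfl (by linarith) (by linarith) (by linarith) (by norm_num)
  have h2 : II n (d n) a b ≤ II n (d n) 0 1 :=
    II_mono n hn.1 (by norm_num) ha0 hab hb1 le_rfl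
  have h3 := II_add n hn.1 le_rfl (by norm_num : (-1 : ℝ) ≤ 0) zero_le_one le_rfl
  exact ⟨by linarith, by linarith⟩

/-- behavior of the typical height in the fast regimes (`d/n → 0`):
(i) subexponential, (ii) exponential, (iii) superexponential. -/
theorem typical_height_fast (d : ℕ → ℕ)
    (hd : ∀ᶠ n in atTop, 2 ≤ d n ∧ d n < n)
    (hdn : Tendsto (fun n : ℕ => (d n : ℝ) / (n : ℝ)) atTop (nhds 0)) :
    -- (i) subexponential regime: √(d/ln(n/d)) · H_typ → √2
    ((Tendsto (fun n : ℕ => (d n : ℝ)) atTop atTop ∧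
        Tendsto (fun n : ℕ => Real.log n / (d n : ℝ)) atTop (nhds 0)) →
      ∀ ε : ℝ, 0 < ε → ε < Real.sqrt 2 →
        Tendsto (fun n : ℕ =>
            II n (d n)
              ((Real.sqrt 2 - ε) * Real.sqrt (Real.log ((n : ℝ) / (d n : ℝ)) / (d n : ℝ)))
              ((Real.sqrt 2 + ε) * Real.sqrt (Real.log ((n : ℝ) / (d n : ℝ)) / (d n : ℝ))) /
            II n (d n) (-1) 1) atTop (nhds 1)) ∧
    -- (ii) exponential regime: H_typ → √(1 - e^{-2ρ})
    (∀ ρ : ℝ, 0 < ρ → Tendsto (fun n : ℕ => Real.log n / (d n : ℝ)) atTop (nhds ρ) →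
      ∀ ε : ℝ, 0 < ε → ε < Real.sqrt (1 - Real.exp (-2 * ρ)) →
        Tendsto (fun n : ℕ =>
            II n (d n) (Real.sqrt (1 - Real.exp (-2 * ρ)) - ε)
              (min (Real.sqrt (1 - Real.exp (-2 * ρ)) + ε) 1) /
            II n (d n) (-1) 1) atTop (nhds 1)) ∧
    -- (iii) superexponential regime: -((d-1)/ln n)·ln(1 - H_typ²) → 2
    (Tendsto (fun n : ℕ => Real.log n / (d n : ℝ)) atTop atTop →
      ∀ ε : ℝ, 0 < ε → ε < 2 →
        Tendsto (fun n : ℕ =>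
            (II n (d n) (Real.sqrt (1 - (n : ℝ) ^ (-(2 - ε) / ((d n : ℝ) - 1))))
                (Real.sqrt (1 - (n : ℝ) ^ (-(2 + ε) / ((d n : ℝ) - 1)))) +
              II n (d n) (-(Real.sqrt (1 - (n : ℝ) ^ (-(2 + ε) / ((d n : ℝ) - 1)))))
                (-(Real.sqrt (1 - (n : ℝ) ^ (-(2 - ε) / ((d n : ℝ) - 1)))))) /
            II n (d n) (-1) 1) atTop (nhds 1)) := by
  exact ⟨fun h _ => typical_height_subexponential hd hdn h.1 h.2,
    fun _ hρ hlog _ => typical_height_exponential hd hdn hρ hlog,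
    fun hlog _ => typical_height_superexponential hd hdn hlog⟩
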